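/- Let R be a commutative noetherian ring. The assignments φ ↦ F(φ), where F(φ)(p) = sup{i + 1 : i ∈ ℤ, p ∈ φ(i)} (supremum of the empty set being −∞), and f ↦ Φ(f), where Φ(f)(i) = {p ∈ Spec R : f(p) > i}, give mutually inverse bijections between the set of sp-filtrations of Spec R satisfying the weak Cousin condition and the set of t-functions on Spec R. -/

import Mathlib

open CategoryTheory

universe w u

noncomputable section

/-- A subset `W` of `Spec R` is specialization-closed if `V(p) ⊆ W` for every `p ∈ W`. -/
def SpecializationClosed {R : Type u} [CommRing R] (W : Set (PrimeSpectrum R)) : Prop :=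
  ∀ p ∈ W, PrimeSpectrum.zeroLocus (p.asIdeal : Set R) ⊆ W

section Filtrations

variable {R : Type u} [CommRing R]

/-- An sp-filtration of `Spec R`: a decreasing sequence of specialization-closed subsets. -/
def IsSPFiltration (φ : ℤ → Set (PrimeSpectrum R)) : Prop :=
  (∀ i : ℤ, SpecializationClosed (φ i)) ∧ ∀ i : ℤ, φ (i + 1) ⊆ φ i

/-- An sp-filtration satisfies the weak Cousin condition if for every integer `i` and every
saturated inclusion `p ⊊ q` of primes, `q ∈ φ(i)` implies `p ∈ φ(i-1)`. -/
def SatisfiesWeakCousin (φ : ℤ → Set (PrimeSpectrum R)) : Prop :=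
  ∀ i : ℤ, ∀ p q : PrimeSpectrum R, p ⋖ q → q ∈ φ i → p ∈ φ (i - 1)

/-- The map `F`, sending a filtration `φ` to the function
`p ↦ sup {i + 1 : i ∈ ℤ, p ∈ φ(i)}` with values in `ℤ ∪ {±∞}`
(the supremum of the empty set being `-∞`). -/
def filtToFun (φ : ℤ → Set (PrimeSpectrum R)) (p : PrimeSpectrum R) : WithTop (WithBot ℤ) :=
  sSup ((fun i : ℤ => (((i + 1 : ℤ) : WithBot ℤ) : WithTop (WithBot ℤ))) '' {i : ℤ | p ∈ φ i})

/-- The map `Φ`, sending a function `f : Spec R → ℤ ∪ {±∞}` to the filtration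
`i ↦ {p ∈ Spec R : f(p) > i}`. -/
def funToFilt (f : PrimeSpectrum R → WithTop (WithBot ℤ)) (i : ℤ) : Set (PrimeSpectrum R) :=
  {p | (((i : ℤ) : WithBot ℤ) : WithTop (WithBot ℤ)) < f p}

end Filtrations

/-- The depth of a module `N` over a noetherian local ring `A`, defined as
`inf { i | Ext_A^i(k, N) ≠ 0 }` where `k` is the residue field of `A`
(the infimum of the empty set being `∞`). -/
def moduleDepth (A : Type u) [CommRing A] [IsLocalRing A]
    (N : Type u) [AddCommGroup N] [Module A N] : ℕ∞ :=
  sInf {i : ℕ∞ | ∃ m : ℕ, i = m ∧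
    Nontrivial (((Ext A (ModuleCat.{u} A) m).obj
      (Opposite.op (ModuleCat.of A (IsLocalRing.ResidueField A)))).obj (ModuleCat.of A N))}

/-- `height (p/q)`: the supremum of the lengths of chains of primes between `q` and `p`. -/
def relHeight {R : Type u} [CommRing R] (q p : PrimeSpectrum R) : ℕ∞ :=
  ⨆ (c : LTSeries (PrimeSpectrum R)) (_ : c.head = q ∧ c.last = p), (c.length : ℕ∞)

/-- The depth of the localized module `M_q` over the local ring `R_q`. -/
def localizedDepth {R : Type u} [CommRing R] (q : PrimeSpectrum R)
    (M : Type u) [AddCommGroup M] [Module R M] : ℕ∞ :=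
  moduleDepth (Localization.AtPrime q.asIdeal) (LocalizedModule q.asIdeal.primeCompl M)

/-- The canonical embedding of `ℕ ∪ {∞}` into `ℤ ∪ {∞}`. -/
def enatToWithTopInt : ℕ∞ → WithTop ℤ := WithTop.map (Nat.cast : ℕ → ℤ)

/-- The canonical embedding of `ℕ ∪ {∞}` into `ℤ ∪ {±∞}`. -/
def enatToE : ℕ∞ → WithTop (WithBot ℤ) := WithTop.map (fun m : ℕ => (m : WithBot ℤ))

/-- A `t`-function on `Spec R`: a map `f : Spec R → ℤ ∪ {±∞}` such that
`f(p) ≤ f(q) ≤ f(p) + height (q/p)` for all inclusions `p ⊆ q` of primes. -/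
def IsTFunction {R : Type u} [CommRing R] (f : PrimeSpectrum R → WithTop (WithBot ℤ)) : Prop :=
  ∀ p q : PrimeSpectrum R, p ≤ q → f p ≤ f q ∧ f q ≤ f p + enatToE (relHeight p q)

/-- An inequality `x ≤ y + n` in `ℤ ∪ {±∞}` is detected by the integers below `x` and `y`. -/
lemma le_add_natCast_iff_forall_int_lt (x y : WithTop (WithBot ℤ)) (n : ℕ) :
    x ≤ y + (((n : ℤ) : WithBot ℤ) : WithTop (WithBot ℤ)) ↔
      ∀ i : ℤ, ((i : WithBot ℤ) : WithTop (WithBot ℤ)) < x →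
        (((i - n : ℤ) : WithBot ℤ) : WithTop (WithBot ℤ)) < y := by
  induction y with
  | top => simp
  | coe y =>
    induction x with
    | top =>
      simp only [← WithTop.coe_add, top_le_iff, WithTop.coe_ne_top, WithTop.coe_lt_top,
        WithTop.coe_lt_coe, true_imp_iff, false_iff, not_forall, not_lt]
      induction y with
      | bot => simp
      | coe y => exact ⟨y + n, by simp⟩
    | coe x =>
      rw [← WithTop.coe_add, WithTop.coe_le_coe]
      simp only [WithTop.coe_lt_coe]
      induction x with
      | bot => simp
      | coe x =>
        induction y with
        | bot =>
          simp only [WithBot.bot_add, le_bot_iff, WithBot.coe_ne_bot, WithBot.coe_lt_coe,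
            not_lt_bot, false_iff, not_forall]
          exact ⟨x - 1, by simp⟩
        | coe y =>
          rw [← WithBot.coe_add]
          simp only [WithBot.coe_le_coe, WithBot.coe_lt_coe]
          exact ⟨fun h i hi => by omega, fun h => by have := h (x - 1) (by omega); omega⟩

lemma le_iff_forall_int_lt (x y : WithTop (WithBot ℤ)) :
    x ≤ y ↔ ∀ i : ℤ, ((i : WithBot ℤ) : WithTop (WithBot ℤ)) < x →
      ((i : WithBot ℤ) : WithTop (WithBot ℤ)) < y := by
  simpa using le_add_natCast_iff_forall_int_lt x y 0

lemma enatToE_natCast (n : ℕ) :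
    enatToE n = (((n : ℤ) : WithBot ℤ) : WithTop (WithBot ℤ)) :=
  rfl

lemma enatToE_top : enatToE ⊤ = ⊤ :=
  rfl

section PrimeSpectrum

variable {R : Type u} [CommRing R]

lemma LTSeries.length_le_relHeight (c : LTSeries (PrimeSpectrum R)) :
    (c.length : ℕ∞) ≤ relHeight c.head c.last :=
  le_iSup₂_of_le c ⟨rfl, rfl⟩ le_rfl

lemma relHeight_add_one_le {p r q : PrimeSpectrum R} (hpr : p ≤ r) (hrq : r < q) :
    relHeight p r + 1 ≤ relHeight p q := by
  have hne : Nonempty {c : LTSeries (PrimeSpectrum R) // c.head = p ∧ c.last = r} := by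
    rcases hpr.eq_or_lt with rfl | h
    · exact ⟨RelSeries.singleton _ p, rfl, rfl⟩
    · exact ⟨(RelSeries.singleton _ p).snoc r h, RelSeries.head_snoc _ _ _,
        RelSeries.last_snoc _ _ _⟩
  rw [relHeight, iSup_subtype', ENat.iSup_add]
  refine iSup_le fun ⟨c, hp, hr⟩ => ?_
  have hlt : c.last < q := hr ▸ hrq
  have := LTSeries.length_le_relHeight (c.snoc q hlt)
  simpa [hp] using this

lemma relHeight_le_one_of_covBy {p q : PrimeSpectrum R} (h : p ⋖ q) : relHeight p q ≤ 1 := by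
  refine iSup₂_le fun c ⟨hp, hq⟩ => ?_
  by_contra! hc
  have hc : 1 < c.length := by exact_mod_cast hc
  refine h.2 (c := c ⟨1, by omega⟩) ?_ ?_
  · rw [← hp]
    exact c.strictMono (Fin.lt_def.2 (by simp))
  · rw [← hq]
    exact c.strictMono (Fin.lt_def.2 (by simpa using hc))

lemma isSPFiltration_iff {φ : ℤ → Set (PrimeSpectrum R)} :
    IsSPFiltration φ ↔ (∀ i, IsUpperSet (φ i)) ∧ Antitone φ :=
  ⟨fun h => ⟨fun i _ _ hpq hp => h.1 i _ hp hpq, antitone_int_of_succ_le h.2⟩,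
    fun h => ⟨fun i _ hp _ hpq => h.1 i hpq hp, fun i => h.2 (by omega)⟩⟩

lemma lt_filtToFun_iff {φ : ℤ → Set (PrimeSpectrum R)} (hφ : Antitone φ) (i : ℤ)
    (p : PrimeSpectrum R) :
    ((i : WithBot ℤ) : WithTop (WithBot ℤ)) < filtToFun φ p ↔ p ∈ φ i := by
  refine lt_sSup_iff.trans ?_
  simp only [Set.exists_mem_image, Set.mem_ofPred_eq, WithTop.coe_lt_coe, WithBot.coe_lt_coe]
  exact ⟨fun ⟨j, hj, hij⟩ => hφ (by omega) hj, fun h => ⟨i, h, by omega⟩⟩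

lemma antitone_funToFilt (f : PrimeSpectrum R → WithTop (WithBot ℤ)) : Antitone (funToFilt f) :=
  fun _ _ hij _ hp =>
    (WithTop.coe_le_coe.2 (WithBot.coe_le_coe.2 hij)).trans_lt hp

/-- Iterating the weak Cousin condition along a saturated chain of primes. -/
lemma SatisfiesWeakCousin.mem_of_relHeight_le [IsNoetherianRing R]
    {φ : ℤ → Set (PrimeSpectrum R)} (hφ : Antitone φ) (hc : SatisfiesWeakCousin φ) (n : ℕ)
    {p q : PrimeSpectrum R} (hpq : p ≤ q) (hn : relHeight p q ≤ n) {i : ℤ} (hq : q ∈ φ i) :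
    p ∈ φ (i - n) := by
  induction n generalizing q i with
  | zero =>
    rcases hpq.eq_or_lt with rfl | h
    · simpa using hq
    · have := (relHeight_add_one_le le_rfl h).trans hn
      simp at this
  | succ n ih =>
    rcases hpq.eq_or_lt with rfl | h
    · exact hφ (by omega) hq
    · have : WellFoundedGT (PrimeSpectrum R) :=
        (show StrictMono (PrimeSpectrum.asIdeal (R := R)) from fun _ _ h => h).wellFoundedGT
      obtain ⟨r, hpr, hrq⟩ := exists_le_covBy_of_lt h
      have hr : relHeight p r + 1 ≤ n + 1 := by
        exact_mod_cast (relHeight_add_one_le hpr hrq.lt).trans hn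
      have := ih hpr ((ENat.add_le_add_iff_right ENat.one_ne_top).1 hr) (hc i r q hrq hq)
      exact hφ (by push_cast; omega) this

lemma isTFunction_filtToFun [IsNoetherianRing R] {φ : ℤ → Set (PrimeSpectrum R)}
    (hφ : IsSPFiltration φ) (hc : SatisfiesWeakCousin φ) : IsTFunction (filtToFun φ) := by
  obtain ⟨hup, hanti⟩ := isSPFiltration_iff.1 hφ
  refine fun p q hpq => ⟨(le_iff_forall_int_lt _ _).2 fun i => ?_, ?_⟩
  · simpa only [lt_filtToFun_iff hanti] using @hup i p q hpq
  · cases hn : relHeight p q with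
    | top => simp [enatToE_top]
    | coe n =>
      rw [enatToE_natCast, le_add_natCast_iff_forall_int_lt]
      simp only [lt_filtToFun_iff hanti]
      exact fun i => hc.mem_of_relHeight_le hanti n hpq hn.le

lemma IsTFunction.isSPFiltration_funToFilt {f : PrimeSpectrum R → WithTop (WithBot ℤ)}
    (hf : IsTFunction f) : IsSPFiltration (funToFilt f) :=
  isSPFiltration_iff.2
    ⟨fun _ p q hpq hp => lt_of_lt_of_le hp (hf p q hpq).1, antitone_funToFilt f⟩

lemma IsTFunction.satisfiesWeakCousin_funToFilt {f : PrimeSpectrum R → WithTop (WithBot ℤ)}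
    (hf : IsTFunction f) : SatisfiesWeakCousin (funToFilt f) := by
  intro i p q hpq hq
  have hle : f q ≤ f p + enatToE (1 : ℕ) :=
    (hf p q hpq.le).2.trans <| add_le_add_right
      ((WithTop.map_le_iff _ (by simp)).2 (relHeight_le_one_of_covBy hpq)) _
  rw [enatToE_natCast, le_add_natCast_iff_forall_int_lt] at hle
  exact hle i hq

lemma filtToFun_funToFilt (f : PrimeSpectrum R → WithTop (WithBot ℤ)) :
    filtToFun (funToFilt f) = f := by
  have h (p : PrimeSpectrum R) (i : ℤ) := lt_filtToFun_iff (antitone_funToFilt f) i p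
  exact funext fun p => le_antisymm
    ((le_iff_forall_int_lt _ _).2 fun i => (h p i).1)
    ((le_iff_forall_int_lt _ _).2 fun i => (h p i).2)

lemma funToFilt_filtToFun {φ : ℤ → Set (PrimeSpectrum R)} (hφ : Antitone φ) :
    funToFilt (filtToFun φ) = φ :=
  funext fun i => Set.ext fun p => lt_filtToFun_iff hφ i p

end PrimeSpectrum

/-- The assignments `φ ↦ F(φ)` and `f ↦ Φ(f)` give mutually inverse bijections between the
sp-filtrations of `Spec R` satisfying the weak Cousin condition and the `t`-functions on
`Spec R`. -/
theorem weakCousin_spFiltrations_equiv_tFunctions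
    (R : Type u) [CommRing R] [IsNoetherianRing R] :
    (∀ φ : ℤ → Set (PrimeSpectrum R), IsSPFiltration φ → SatisfiesWeakCousin φ →
      IsTFunction (filtToFun φ)) ∧
    (∀ f : PrimeSpectrum R → WithTop (WithBot ℤ), IsTFunction f →
      IsSPFiltration (funToFilt f) ∧ SatisfiesWeakCousin (funToFilt f)) ∧
    (∀ f : PrimeSpectrum R → WithTop (WithBot ℤ), IsTFunction f →
      filtToFun (funToFilt f) = f) ∧
    (∀ φ : ℤ → Set (PrimeSpectrum R), IsSPFiltration φ → SatisfiesWeakCousin φ →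
      funToFilt (filtToFun φ) = φ) := by
  exact ⟨fun _ hφ hc => isTFunction_filtToFun hφ hc,
    fun _ hf => ⟨hf.isSPFiltration_funToFilt, hf.satisfiesWeakCousin_funToFilt⟩,
    fun f _ => filtToFun_funToFilt f,
    fun _ hφ _ => funToFilt_filtToFun (isSPFiltration_iff.1 hφ).2⟩
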